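/- arXiv:2311.00963 — 2 statements merged into one kernel-verified Lean document; each statement's English description precedes it below -/
import Mathlib

section
/- For every complex number a, the W₁₂ singularity f(x,y) = x⁴ + y⁵ + a x² y³ satisfies lct₀(f) = 9/20. -/
open MeasureTheory

/-- The log canonical threshold at the origin of a function `f : ℂ × ℂ → ℂ`,
defined via the complex singularity exponent. -/
noncomputable def lct₀ (f : ℂ × ℂ → ℂ) : ℝ :=
  sSup { c : ℝ | 0 ≤ c ∧ ∃ ε : ℝ, 0 < ε ∧
    IntegrableOn (fun p : ℂ × ℂ => ‖f p‖ ^ (-2 * c)) (Metric.ball (0 : ℂ × ℂ) ε) volume }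

lemma half_le_norm_sub_or {u v w : ℂ} {d : ℝ} (h : d ≤ ‖u - v‖) :
    d / 2 ≤ ‖w - u‖ ∨ d / 2 ≤ ‖w - v‖ := by
  by_contra! hh
  have : ‖u - v‖ ≤ ‖w - v‖ + ‖w - u‖ := by
    have := norm_sub_le (w - v) (w - u)
    rwa [show w - v - (w - u) = u - v by ring] at this
  linarith

lemma exists_root_norm_sub_le_norm_sq_sub {r w : ℂ} (hr : 1 / 2 ≤ ‖r‖) :
    ∃ s : ℂ, (s = r ∨ s = -r) ∧ 1 / 2 * ‖w - s‖ ≤ ‖w ^ 2 - r ^ 2‖ := by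
  have h : (1 : ℝ) ≤ ‖r - -r‖ := by
    rw [show r - -r = 2 * r by ring, norm_mul]; norm_num; linarith
  have e : ‖w ^ 2 - r ^ 2‖ = ‖w - r‖ * ‖w - -r‖ := by rw [← norm_mul]; congr 1; ring
  rcases half_le_norm_sub_or (w := w) h with h | h
  · exact ⟨-r, Or.inr rfl, by rw [e]; gcongr⟩
  · exact ⟨r, Or.inl rfl, by rw [e, mul_comm]; gcongr⟩

lemma exists_biquadratic_roots {b e : ℂ} (hb : ‖b‖ ≤ 1) (he : ‖e‖ = 1) :
    ∃ r t : ℂ, 1 / 2 ≤ ‖r‖ ∧ 1 / 2 ≤ ‖t‖ ∧ 1 ≤ ‖r ^ 2 - t ^ 2‖ ∧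
      ∀ z : ℂ, z ^ 4 + b * z ^ 2 + e = (z ^ 2 - r ^ 2) * (z ^ 2 - t ^ 2) := by
  obtain ⟨D, hD⟩ := IsAlgClosed.exists_pow_nat_eq (b ^ 2 - 4 * e) (n := 2) (by norm_num)
  obtain ⟨r, hr⟩ := IsAlgClosed.exists_pow_nat_eq ((-b + D) / 2) (n := 2) (by norm_num)
  obtain ⟨t, ht⟩ := IsAlgClosed.exists_pow_nat_eq ((-b - D) / 2) (n := 2) (by norm_num)
  have hprod : r ^ 2 * t ^ 2 = e := by rw [hr, ht]; linear_combination -hD / 4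
  have hsum : r ^ 2 + t ^ 2 = -b := by rw [hr, ht]; ring
  have hdiff : r ^ 2 - t ^ 2 = D := by rw [hr, ht]; ring
  have hp : ‖r‖ ^ 2 * ‖t‖ ^ 2 = 1 := by rw [← norm_pow, ← norm_pow, ← norm_mul, hprod, he]
  have h1 : ‖t‖ ^ 2 ≤ 1 + ‖r‖ ^ 2 := by
    rw [← norm_pow, ← norm_pow, show t ^ 2 = -b - r ^ 2 by rw [← hsum]; ring]
    calc _ ≤ ‖-b‖ + ‖r ^ 2‖ := norm_sub_le _ _
      _ ≤ _ := by rw [norm_neg]; gcongr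
  have h2 : ‖r‖ ^ 2 ≤ 1 + ‖t‖ ^ 2 := by
    rw [← norm_pow, ← norm_pow, show r ^ 2 = -b - t ^ 2 by rw [← hsum]; ring]
    calc _ ≤ ‖-b‖ + ‖t ^ 2‖ := norm_sub_le _ _
      _ ≤ _ := by rw [norm_neg]; gcongr
  have key : ∀ p q : ℝ, 0 ≤ p → p ^ 2 * q ^ 2 = 1 → q ^ 2 ≤ 1 + p ^ 2 → 1 / 2 ≤ p := by
    intro p q hp hpq hq
    by_contra! h
    have : p ^ 2 ≤ 1 / 4 := by nlinarith
    nlinarith [sq_nonneg q, sq_nonneg p]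
  refine ⟨r, t, key _ _ (norm_nonneg _) hp h1, key _ _ (norm_nonneg _) (by linarith) h2, ?_, ?_⟩
  · rw [hdiff]
    have h3 : ‖D‖ ^ 2 = ‖4 * e - b ^ 2‖ := by rw [← norm_pow, hD, norm_sub_rev]
    have h4 : ‖4 * e‖ - ‖b ^ 2‖ ≤ ‖4 * e - b ^ 2‖ := norm_sub_norm_le _ _
    rw [norm_mul, he, norm_pow] at h4
    norm_num at h4
    nlinarith [norm_nonneg D, norm_nonneg b]
  · intro z
    linear_combination z ^ 2 * hsum - hprod

/-- A biquadratic polynomial with well-separated roots is bounded below by the distance to one of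
its roots near them, and by a quartic in `‖z‖` elsewhere. -/
lemma biquadratic_norm_lower_bound {b e r t : ℂ} (hb : ‖b‖ ≤ 1) (he : ‖e‖ = 1)
    (hr : 1 / 2 ≤ ‖r‖) (ht : 1 / 2 ≤ ‖t‖) (hd : 1 ≤ ‖r ^ 2 - t ^ 2‖)
    (hf : ∀ z : ℂ, z ^ 4 + b * z ^ 2 + e = (z ^ 2 - r ^ 2) * (z ^ 2 - t ^ 2)) (z : ℂ) :
    1 / 400 * (1 + ‖z‖) ^ 4 ≤ ‖z ^ 4 + b * z ^ 2 + e‖ ∨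
      ∃ s ∈ ({r, -r, t, -t} : Finset ℂ), ‖z - s‖ < 1 ∧
        1 / 400 * ‖z - s‖ ≤ ‖z ^ 4 + b * z ^ 2 + e‖ := by
  rcases le_or_gt 2 ‖z‖ with hz | hz
  · left
    have h1 : ‖z ^ 4‖ ≤ ‖z ^ 4 + b * z ^ 2 + e‖ + ‖b * z ^ 2‖ + ‖e‖ := by
      calc ‖z ^ 4‖ = ‖z ^ 4 + b * z ^ 2 + e - b * z ^ 2 - e‖ := by congr 1; ring
        _ ≤ ‖z ^ 4 + b * z ^ 2 + e - b * z ^ 2‖ + ‖e‖ := norm_sub_le _ _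
        _ ≤ _ := by gcongr; exact norm_sub_le _ _
    rw [norm_mul, norm_pow, norm_pow, he] at h1
    have h2 : ‖b‖ * ‖z‖ ^ 2 ≤ 1 * ‖z‖ ^ 2 := by gcongr
    have h3 : (1 + ‖z‖) ^ 4 ≤ (2 * ‖z‖) ^ 4 := by gcongr; linarith
    nlinarith [sq_nonneg ‖z‖, mul_self_nonneg (‖z‖ ^ 2 - 4)]
  · have : ∃ s ∈ ({r, -r, t, -t} : Finset ℂ),
        1 / 4 * ‖z - s‖ ≤ ‖z ^ 4 + b * z ^ 2 + e‖ := by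
      rw [hf, norm_mul]
      rcases half_le_norm_sub_or (w := z ^ 2) hd with h | h
      · obtain ⟨s, hs, h'⟩ := exists_root_norm_sub_le_norm_sq_sub (w := z) ht
        refine ⟨s, by rcases hs with rfl | rfl <;> simp, ?_⟩
        nlinarith [norm_nonneg (z - s)]
      · obtain ⟨s, hs, h'⟩ := exists_root_norm_sub_le_norm_sq_sub (w := z) hr
        refine ⟨s, by rcases hs with rfl | rfl <;> simp, ?_⟩
        nlinarith [norm_nonneg (z - s)]
    obtain ⟨s, hs, h⟩ := this
    rcases lt_or_ge ‖z - s‖ 1 with h1 | h1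
    · exact Or.inr ⟨s, hs, h1, by linarith [norm_nonneg (z - s)]⟩
    · left
      have : (1 + ‖z‖) ^ 4 ≤ 3 ^ 4 := by gcongr; linarith
      linarith

lemma ennreal_rpow_neg_le_rpow_neg {x y : ENNReal} {p : ℝ} (hp : 0 ≤ p) (h : x ≤ y) :
    y ^ (-p) ≤ x ^ (-p) := by
  rw [ENNReal.rpow_neg, ENNReal.rpow_neg, ENNReal.inv_le_inv]
  exact ENNReal.rpow_le_rpow h hp

lemma setLIntegral_ball_enorm_rpow_lt_top {q : ℝ} (hq : q < 2) (R : ℝ) :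
    ∫⁻ z in Metric.ball (0 : ℂ) R, ‖z‖ₑ ^ (-q) < ⊤ := by
  have h := integrableOn_ball_of_norm_le_rpow (F := ℝ) (μ := (volume : Measure ℂ)) (C := 1)
    (α := q) (r := R) (f := fun z => ‖z‖ ^ (-q)) (by simp) (by simpa using hq)
    (ae_of_all _ fun z => by simp [abs_of_nonneg (Real.rpow_nonneg (norm_nonneg z) _)])
    (Measurable.aestronglyMeasurable (by fun_prop))
  refine lt_of_eq_of_lt (lintegral_congr_ae ?_) h.2
  refine ae_restrict_of_ae ?_
  filter_upwards [Measure.ae_ne volume (0 : ℂ)] with z hz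
  have : 0 < ‖z‖ := norm_pos_iff.2 hz
  rw [← ofReal_norm, ENNReal.ofReal_rpow_of_pos this,
    Real.enorm_of_nonneg (Real.rpow_nonneg (norm_nonneg z) _)]

lemma lintegral_eq_mul_lintegral_smul {s : ℝ} (hs : 0 < s) {F : ℂ → ENNReal} (hF : Measurable F) :
    ∫⁻ z, F z = ENNReal.ofReal (s ^ 2) * ∫⁻ z, F ((s : ℂ) * z) := by
  have h : ∫⁻ z, F z ∂(Measure.map (s • ·) (volume : Measure ℂ)) = ∫⁻ z, F ((s : ℂ) * z) := by
    rw [lintegral_map hF (by fun_prop)]; simp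
  rw [← h, Measure.map_addHaar_smul _ hs.ne', lintegral_smul_measure, smul_eq_mul, ← mul_assoc,
    ← ENNReal.ofReal_mul (by positivity), Complex.finrank_real_complex, abs_of_pos (by positivity),
    mul_inv_cancel₀ (by positivity)]
  simp

open scoped ENNReal in
/-- The integrals of `‖z⁴ + b z² + e‖⁻ᵖ` over the plane are bounded uniformly in the parameters. -/
lemma exists_lintegral_biquadratic_le {p : ℝ} (hp : 1 / 2 < p) (hp2 : p < 2) :
    ∃ K : ℝ≥0∞, K < ⊤ ∧ ∀ b e : ℂ, ‖b‖ ≤ 1 → ‖e‖ = 1 →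
      ∫⁻ z : ℂ, ‖z ^ 4 + b * z ^ 2 + e‖ₑ ^ (-p) ≤ K := by
  set κ : ℝ≥0∞ := ENNReal.ofReal (1 / 400)
  set φ : ℂ → ℝ≥0∞ := (Metric.ball (0 : ℂ) 1).indicator fun z => ‖z‖ₑ ^ (-p) with hφ
  set ψ : ℂ → ℝ≥0∞ := fun z => ENNReal.ofReal ((1 + ‖z‖) ^ (-(4 * p))) with hψ
  have hκ0 : κ ≠ 0 := by simp [κ]
  have hκt : κ ≠ ⊤ := ENNReal.ofReal_ne_top
  have hφm : Measurable φ := Measurable.indicator (by fun_prop) measurableSet_ball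
  have hφi : ∫⁻ z, φ z < ⊤ := by
    rw [hφ, lintegral_indicator measurableSet_ball]
    exact setLIntegral_ball_enorm_rpow_lt_top hp2 1
  have hψi : ∫⁻ z, ψ z < ⊤ := finite_integral_one_add_norm (by simp; linarith)
  have hψm : Measurable ψ := by fun_prop
  refine ⟨κ ^ (-p) * ((∫⁻ z, ψ z) + 4 * ∫⁻ z, φ z), ?_, fun b e hb he => ?_⟩
  · refine ENNReal.mul_lt_top (ENNReal.rpow_ne_top_of_ne_zero hκ0 hκt).lt_top ?_
    exact ENNReal.add_lt_top.2 ⟨hψi, ENNReal.mul_lt_top (by simp) hφi⟩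
  obtain ⟨r, t, hr, ht, hd, hf⟩ := exists_biquadratic_roots hb he
  set S : Finset ℂ := {r, -r, t, -t} with hS
  have hpt (z : ℂ) : ‖z ^ 4 + b * z ^ 2 + e‖ₑ ^ (-p) ≤
      κ ^ (-p) * (ψ z + ∑ s ∈ S, φ (z - s)) := by
    rcases biquadratic_norm_lower_bound hb he hr ht hd hf z with h | ⟨s, hs, h1, h⟩
    · have h' : κ * ENNReal.ofReal ((1 + ‖z‖) ^ 4) ≤ ‖z ^ 4 + b * z ^ 2 + e‖ₑ := by
        rw [← ENNReal.ofReal_mul (by norm_num), ← ofReal_norm]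
        exact ENNReal.ofReal_le_ofReal h
      have hpos : 0 < 1 + ‖z‖ := by positivity
      calc _ ≤ (κ * ENNReal.ofReal ((1 + ‖z‖) ^ 4)) ^ (-p) :=
            ennreal_rpow_neg_le_rpow_neg (by linarith) h'
        _ = κ ^ (-p) * ψ z := by
            rw [ENNReal.mul_rpow_of_ne_top hκt ENNReal.ofReal_ne_top,
              ENNReal.ofReal_rpow_of_pos (pow_pos hpos 4), ← Real.rpow_natCast,
              ← Real.rpow_mul hpos.le]
            simp [hψ]
        _ ≤ _ := by gcongr; exact le_self_add
    · have h' : κ * ‖z - s‖ₑ ≤ ‖z ^ 4 + b * z ^ 2 + e‖ₑ := by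
        rw [← ofReal_norm, ← ofReal_norm, ← ENNReal.ofReal_mul (by norm_num)]
        exact ENNReal.ofReal_le_ofReal h
      have hφs : φ (z - s) = ‖z - s‖ₑ ^ (-p) :=
        Set.indicator_of_mem (by simpa using h1) _
      calc _ ≤ (κ * ‖z - s‖ₑ) ^ (-p) :=
            ennreal_rpow_neg_le_rpow_neg (by linarith) h'
        _ = κ ^ (-p) * φ (z - s) := by rw [ENNReal.mul_rpow_of_ne_top hκt enorm_ne_top, hφs]
        _ ≤ κ ^ (-p) * ∑ s ∈ S, φ (z - s) := by
            gcongr; exact Finset.single_le_sum (f := fun s => φ (z - s)) (by simp) hs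
        _ ≤ _ := by gcongr; exact le_add_self
  calc _ ≤ ∫⁻ z, κ ^ (-p) * (ψ z + ∑ s ∈ S, φ (z - s)) := lintegral_mono hpt
    _ = κ ^ (-p) * ((∫⁻ z, ψ z) + ∑ s ∈ S, ∫⁻ z, φ (z - s)) := by
        rw [lintegral_const_mul _ (by fun_prop), lintegral_add_left hψm,
          lintegral_finsetSum _ (by fun_prop)]
    _ ≤ _ := by
        simp_rw [lintegral_sub_right_eq_self φ, Finset.sum_const, nsmul_eq_mul]
        gcongr
        exact_mod_cast Finset.card_le_four

open scoped ENNReal in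
/-- Rescaling `x` by `‖y‖^(5/4)` reduces a slice of the `W₁₂` integral to a biquadratic one. -/
lemma lintegral_W12_slice_le {p : ℝ} {K : ℝ≥0∞}
    (hK : ∀ b e : ℂ, ‖b‖ ≤ 1 → ‖e‖ = 1 → ∫⁻ z : ℂ, ‖z ^ 4 + b * z ^ 2 + e‖ₑ ^ (-p) ≤ K)
    {a y : ℂ} (hy : y ≠ 0) (hay : ‖a‖ ^ 2 * ‖y‖ ≤ 1) :
    ∫⁻ x : ℂ, ‖x ^ 4 + y ^ 5 + a * x ^ 2 * y ^ 3‖ₑ ^ (-p) ≤ ‖y‖ₑ ^ (-(5 * p - 5 / 2)) * K := by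
  have hy0 : 0 < ‖y‖ := norm_pos_iff.2 hy
  set ρ : ℝ := ‖y‖ ^ (1 / 4 : ℝ) with hρ
  have hρ0 : 0 < ρ := Real.rpow_pos_of_pos hy0 _
  have hρ4 : ‖y‖ = ρ ^ 4 := by
    rw [hρ, ← Real.rpow_natCast, ← Real.rpow_mul hy0.le]; norm_num
  have hρc : (ρ : ℂ) ≠ 0 := by exact_mod_cast hρ0.ne'
  set b : ℂ := a * y ^ 3 / (ρ : ℂ) ^ 10 with hb
  set e : ℂ := y ^ 5 / (ρ : ℂ) ^ 20 with he
  have hnb : ‖b‖ ≤ 1 := by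
    have : ‖b‖ = ‖a‖ * ρ ^ 2 := by
      simp only [hb, norm_div, norm_mul, norm_pow, Complex.norm_real, Real.norm_of_nonneg hρ0.le,
        hρ4]
      field_simp
    rw [this]
    rw [hρ4] at hay
    exact (sq_le_one_iff₀ (by positivity)).1 (by nlinarith)
  have hne : ‖e‖ = 1 := by
    simp only [he, norm_div, norm_pow, Complex.norm_real, Real.norm_of_nonneg hρ0.le, hρ4]
    field_simp
  rw [lintegral_eq_mul_lintegral_smul (s := ρ ^ 5) (by positivity) (by fun_prop)]
  have hfac (z : ℂ) : ‖(((ρ ^ 5 : ℝ) : ℂ) * z) ^ 4 + y ^ 5 +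
      a * (((ρ ^ 5 : ℝ) : ℂ) * z) ^ 2 * y ^ 3‖ₑ ^ (-p) =
      ENNReal.ofReal (ρ ^ 20) ^ (-p) * ‖z ^ 4 + b * z ^ 2 + e‖ₑ ^ (-p) := by
    rw [← ENNReal.mul_rpow_of_ne_top ENNReal.ofReal_ne_top enorm_ne_top]
    congr 1
    rw [← ofReal_norm (z ^ 4 + b * z ^ 2 + e), ← ENNReal.ofReal_mul (by positivity), ← ofReal_norm]
    congr 1
    rw [show ρ ^ 20 = ‖(ρ : ℂ) ^ 20‖ by simp [abs_of_pos hρ0], ← norm_mul]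
    congr 1
    rw [hb, he]
    push_cast
    field_simp
    ring
  simp_rw [hfac]
  rw [lintegral_const_mul _ (by fun_prop), ← mul_assoc]
  gcongr
  · rw [ENNReal.ofReal_rpow_of_pos (by positivity), ← ENNReal.ofReal_mul (by positivity),
      ← ofReal_norm, ENNReal.ofReal_rpow_of_pos hy0]
    apply le_of_eq
    congr 1
    rw [hρ4]
    simp only [← Real.rpow_natCast, ← Real.rpow_mul hρ0.le, ← Real.rpow_add hρ0]
    congr 1
    push_cast
    ring
  · exact hK b e hnb hne

lemma integrableOn_W12 (a : ℂ) {c : ℝ} (hc : 1 / 4 < c) (hc' : c < 9 / 20) :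
    IntegrableOn (fun p : ℂ × ℂ => ‖p.1 ^ 4 + p.2 ^ 5 + a * p.1 ^ 2 * p.2 ^ 3‖ ^ (-2 * c))
      (Metric.ball (0 : ℂ × ℂ) (1 / (‖a‖ ^ 2 + 1))) volume := by
  set ε : ℝ := 1 / (‖a‖ ^ 2 + 1)
  obtain ⟨K, hKt, hK⟩ := exists_lintegral_biquadratic_le (p := 2 * c) (by linarith) (by linarith)
  refine ⟨Measurable.aestronglyMeasurable (by fun_prop), ?_⟩
  calc ∫⁻ p in Metric.ball (0 : ℂ × ℂ) ε,
        ‖‖p.1 ^ 4 + p.2 ^ 5 + a * p.1 ^ 2 * p.2 ^ 3‖ ^ (-2 * c)‖ₑ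
      ≤ ∫⁻ p in Metric.ball (0 : ℂ) ε ×ˢ Metric.ball (0 : ℂ) ε,
        ‖p.1 ^ 4 + p.2 ^ 5 + a * p.1 ^ 2 * p.2 ^ 3‖ₑ ^ (-(2 * c)) := by
        rw [ball_prod_same]
        refine lintegral_mono fun p => ?_
        rw [neg_mul, Real.enorm_of_nonneg (Real.rpow_nonneg (norm_nonneg _) _)]
        rcases (norm_nonneg (p.1 ^ 4 + p.2 ^ 5 + a * p.1 ^ 2 * p.2 ^ 3)).eq_or_lt with h | h
        · rw [← h, Real.zero_rpow (by linarith)]; simp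
        · rw [← ofReal_norm, ENNReal.ofReal_rpow_of_pos h]
    _ = ∫⁻ y in Metric.ball (0 : ℂ) ε, ∫⁻ x in Metric.ball (0 : ℂ) ε,
        ‖x ^ 4 + y ^ 5 + a * x ^ 2 * y ^ 3‖ₑ ^ (-(2 * c)) := by
        rw [Measure.volume_eq_prod, ← Measure.prod_restrict,
          lintegral_prod_symm' _ (by fun_prop)]
    _ ≤ ∫⁻ y in Metric.ball (0 : ℂ) ε, ‖y‖ₑ ^ (-(5 * (2 * c) - 5 / 2)) * K := by
        refine lintegral_mono_ae ?_
        filter_upwards [ae_restrict_mem measurableSet_ball,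
          ae_restrict_of_ae (Measure.ae_ne volume (0 : ℂ))] with y hy hy0
        refine (setLIntegral_le_lintegral _ _).trans (lintegral_W12_slice_le hK hy0 ?_)
        have h1 : ‖y‖ ≤ ε := (mem_ball_zero_iff.1 hy).le
        calc ‖a‖ ^ 2 * ‖y‖ ≤ ‖a‖ ^ 2 * ε := by gcongr
          _ ≤ 1 := by
            rw [mul_one_div, div_le_one (by positivity)]; linarith
    _ < ⊤ := by
        rw [lintegral_mul_const _ (by fun_prop)]
        exact ENNReal.mul_lt_top (setLIntegral_ball_enorm_rpow_lt_top (by linarith) ε) hKt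

/-- Size of the `W₁₂` polynomial on a quasi-homogeneous box avoiding its zero set. -/
lemma W12_bounds {a x y : ℂ} {δ t : ℝ} (hδ : δ = 1 / (8 * (1 + ‖a‖))) (ht : 0 < t) (ht1 : t ≤ 1)
    (hx1 : t ^ 5 / 2 ≤ ‖x‖) (hx2 : ‖x‖ ≤ 3 / 2 * t ^ 5) (hy : ‖y‖ ≤ δ * t ^ 4) :
    0 < ‖x ^ 4 + y ^ 5 + a * x ^ 2 * y ^ 3‖ ∧
      ‖x ^ 4 + y ^ 5 + a * x ^ 2 * y ^ 3‖ ≤ 6 * t ^ 20 := by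
  have ha := norm_nonneg a
  have hδ0 : 0 < δ := by rw [hδ]; positivity
  have hδ8 : δ ≤ 1 / 8 := by
    rw [hδ]; exact one_div_le_one_div_of_le (by norm_num) (by linarith)
  have haδ : ‖a‖ * δ ≤ 1 / 8 := by
    rw [hδ, mul_one_div, div_le_div_iff₀ (by positivity) (by norm_num)]; linarith
  have h20 : 0 < t ^ 20 := by positivity
  have hxl : t ^ 20 / 16 ≤ ‖x ^ 4‖ := by
    rw [norm_pow]
    calc t ^ 20 / 16 = (t ^ 5 / 2) ^ 4 := by ring
      _ ≤ _ := by gcongr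
  have hxu : ‖x ^ 4‖ ≤ 81 / 16 * t ^ 20 := by
    rw [norm_pow]
    calc ‖x‖ ^ 4 ≤ (3 / 2 * t ^ 5) ^ 4 := by gcongr
      _ = _ := by ring
  have hyu : ‖y ^ 5‖ ≤ 1 / 64 * t ^ 20 := by
    rw [norm_pow]
    calc ‖y‖ ^ 5 ≤ (1 / 8 * t ^ 4) ^ 5 := by gcongr; exact hy.trans (by gcongr)
      _ = 1 / 8 ^ 5 * t ^ 20 := by ring
      _ ≤ _ := by gcongr; norm_num
  have hm : ‖a * x ^ 2 * y ^ 3‖ ≤ 1 / 64 * t ^ 20 := by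
    rw [norm_mul, norm_mul, norm_pow, norm_pow]
    calc ‖a‖ * ‖x‖ ^ 2 * ‖y‖ ^ 3 ≤ ‖a‖ * (3 / 2 * t ^ 5) ^ 2 * (δ * t ^ 4) ^ 3 := by gcongr
      _ = 9 / 4 * (‖a‖ * δ) * δ ^ 2 * t ^ 2 * t ^ 20 := by ring
      _ ≤ 9 / 4 * (1 / 8) * (1 / 8) ^ 2 * 1 ^ 2 * t ^ 20 := by gcongr
      _ ≤ _ := by gcongr; norm_num
  constructor
  · have : ‖x ^ 4‖ ≤ ‖x ^ 4 + y ^ 5 + a * x ^ 2 * y ^ 3‖ + ‖a * x ^ 2 * y ^ 3‖ + ‖y ^ 5‖ := by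
      calc ‖x ^ 4‖ = ‖x ^ 4 + y ^ 5 + a * x ^ 2 * y ^ 3 - a * x ^ 2 * y ^ 3 - y ^ 5‖ := by
            congr 1; ring
        _ ≤ ‖x ^ 4 + y ^ 5 + a * x ^ 2 * y ^ 3 - a * x ^ 2 * y ^ 3‖ + ‖y ^ 5‖ := norm_sub_le _ _
        _ ≤ _ := by gcongr; exact norm_sub_le _ _
    linarith
  · have := norm_add₃_le (a := x ^ 4) (b := y ^ 5) (c := a * x ^ 2 * y ^ 3)
    linarith

lemma le_of_integrableOn_W12 (a : ℂ) {c ε : ℝ} (hε : 0 < ε)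
    (h : IntegrableOn (fun p : ℂ × ℂ => ‖p.1 ^ 4 + p.2 ^ 5 + a * p.1 ^ 2 * p.2 ^ 3‖ ^ (-2 * c))
      (Metric.ball (0 : ℂ × ℂ) ε) volume) : c ≤ 9 / 20 := by
  by_contra! hlt
  set F : ℂ × ℂ → ℂ := fun p => p.1 ^ 4 + p.2 ^ 5 + a * p.1 ^ 2 * p.2 ^ 3 with hF
  set δ : ℝ := 1 / (8 * (1 + ‖a‖)) with hδ
  have hδ0 : 0 < δ := by positivity
  have hδ1 : δ ≤ 1 := by
    rw [hδ, div_le_one (by positivity)]; linarith [norm_nonneg a]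
  set I := ∫ p in Metric.ball (0 : ℂ × ℂ) ε, ‖F p‖ ^ (-2 * c)
  set M : ℝ := 6 ^ (-2 * c) * (δ ^ 2 / 4 * Real.pi ^ 2) with hM
  have hM0 : 0 < M := by positivity
  have hbound (t : ℝ) (ht : 0 < t) (ht1 : t ≤ 1) (htε : 3 / 2 * t < ε) :
      M * t ^ (-(40 * c - 18)) ≤ I := by
    set S : Set (ℂ × ℂ) :=
      Metric.ball ((t ^ 5 : ℝ) : ℂ) (t ^ 5 / 2) ×ˢ Metric.ball (0 : ℂ) (δ * t ^ 4) with hS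
    have hSmem : ∀ p ∈ S, t ^ 5 / 2 ≤ ‖p.1‖ ∧ ‖p.1‖ ≤ 3 / 2 * t ^ 5 ∧ ‖p.2‖ ≤ δ * t ^ 4 := by
      rintro ⟨x, y⟩ ⟨hx, hy⟩
      have hx' : ‖x - ((t ^ 5 : ℝ) : ℂ)‖ < t ^ 5 / 2 := by simpa [dist_eq_norm] using hx
      have hn : ‖((t ^ 5 : ℝ) : ℂ)‖ = t ^ 5 := by
        rw [Complex.norm_real, Real.norm_of_nonneg (by positivity)]
      have h1 := norm_sub_norm_le x ((t ^ 5 : ℝ) : ℂ)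
      have h2 := norm_sub_norm_le ((t ^ 5 : ℝ) : ℂ) x
      rw [norm_sub_rev] at h2
      exact ⟨by simp only; linarith, by simp only; linarith, (mem_ball_zero_iff.1 hy).le⟩
    have ht5 : t ^ 5 ≤ t := pow_le_of_le_one ht.le ht1 (by norm_num)
    have ht4 : t ^ 4 ≤ t := pow_le_of_le_one ht.le ht1 (by norm_num)
    have hSsub : S ⊆ Metric.ball (0 : ℂ × ℂ) ε := by
      intro p hp
      obtain ⟨-, h2, h3⟩ := hSmem p hp
      rw [mem_ball_zero_iff, Prod.norm_def, max_lt_iff]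
      refine ⟨by linarith, ?_⟩
      have : δ * t ^ 4 ≤ 1 * t ^ 4 := by gcongr
      linarith
    have hSm : MeasurableSet S := measurableSet_ball.prod measurableSet_ball
    have hSvol : volume.real S = (t ^ 5 / 2) ^ 2 * Real.pi * ((δ * t ^ 4) ^ 2 * Real.pi) := by
      have h5 : 0 ≤ t ^ 5 / 2 := by positivity
      have h4 : 0 ≤ δ * t ^ 4 := by positivity
      rw [hS, Measure.volume_eq_prod, measureReal_prod_prod]
      simp only [Measure.real, Complex.volume_ball, ENNReal.toReal_mul, ENNReal.toReal_pow,
        ENNReal.toReal_ofReal h5, ENNReal.toReal_ofReal h4, ENNReal.coe_toReal, NNReal.coe_real_pi]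
    have hSfin : volume S ≠ ⊤ := by
      rw [hS]
      exact (Metric.isBounded_ball.prod Metric.isBounded_ball).measure_lt_top.ne
    have hlow : ∀ p ∈ S, (6 * t ^ 20) ^ (-2 * c) ≤ ‖F p‖ ^ (-2 * c) := by
      intro p hp
      obtain ⟨h1, h2, h3⟩ := hSmem p hp
      obtain ⟨h4, h5⟩ := W12_bounds hδ ht ht1 h1 h2 h3
      exact Real.rpow_le_rpow_of_nonpos h4 h5 (by linarith)
    calc M * t ^ (-(40 * c - 18)) = (6 * t ^ 20) ^ (-2 * c) * volume.real S := by
          have e1 : (t ^ 20 : ℝ) ^ (-2 * c) = t ^ (-(40 * c)) := by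
            rw [← Real.rpow_natCast, ← Real.rpow_mul ht.le]; congr 1; push_cast; ring
          have e2 : t ^ (-(40 * c - 18)) = t ^ (-(40 * c)) * t ^ 18 := by
            rw [← Real.rpow_natCast, ← Real.rpow_add ht]; congr 1; push_cast; ring
          rw [hSvol, Real.mul_rpow (by norm_num) (by positivity), e1, e2, hM]
          ring
      _ ≤ ∫ p in S, ‖F p‖ ^ (-2 * c) :=
          setIntegral_ge_of_const_le_real hSm hSfin hlow (h.mono_set hSsub)
      _ ≤ I := setIntegral_mono_set h
          (ae_of_all _ fun p => Real.rpow_nonneg (norm_nonneg _) _) hSsub.eventuallyLE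
  have hlim : Filter.Tendsto (fun t : ℝ => M * t ^ (-(40 * c - 18)))
      (nhdsWithin 0 (Set.Ioi 0)) Filter.atTop :=
    (tendsto_rpow_neg_nhdsGT_zero (by linarith)).const_mul_atTop hM0
  have hmin : 0 < min 1 (ε / 2) := by positivity
  obtain ⟨t, h1, h2⟩ := ((hlim.eventually_gt_atTop I).and
    (Ioo_mem_nhdsGT hmin)).exists
  have h3 := lt_min_iff.1 h2.2
  exact absurd (hbound t h2.1 h3.1.le (by linarith)) (not_le.2 h1)

theorem lct_W12 (a : ℂ) :
    lct₀ (fun p : ℂ × ℂ => p.1 ^ 4 + p.2 ^ 5 + a * p.1 ^ 2 * p.2 ^ 3) = 9 / 20 := by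
  refine csSup_eq_of_forall_le_of_forall_lt_exists_gt ?_ ?_ ?_
  · exact ⟨3 / 10, by norm_num, _, by positivity,
      integrableOn_W12 a (by norm_num) (by norm_num)⟩
  · rintro c ⟨-, ε, hε, h⟩
    exact le_of_integrableOn_W12 a hε h
  · intro w hw
    obtain ⟨c, hc, hc'⟩ := exists_between (max_lt hw (by norm_num : (1 / 4 : ℝ) < 9 / 20))
    obtain ⟨h1, h2⟩ := max_lt_iff.1 hc
    exact ⟨c, ⟨by linarith, _, by positivity, integrableOn_W12 a h2 hc'⟩, h1⟩
end

section
/- Let a, b, c be complex numbers such that the homogeneous quintic x⁵ + a x³ y² + b x² y³ + y⁵ is square-free in ℂ[x,y]. Then the N₁₆ singularity f(x,y) = x⁵ + a x³ y² + b x² y³ + y⁵ + c x³ y³ satisfies lct₀(f) = 2/5. -/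
open MeasureTheory MvPolynomial

/-- A quintic form whose dehomogenization has a double root `u` is divisible by the square of the
corresponding linear form. -/
lemma sq_dvd_quintic {R : Type*} [CommRing R] (x y a b u : R)
    (h₀ : u ^ 5 + a * u ^ 3 + b * u ^ 2 + 1 = 0)
    (h₁ : 5 * u ^ 4 + 3 * a * u ^ 2 + 2 * b * u = 0) :
    (x - u * y) ^ 2 ∣ x ^ 5 + a * x ^ 3 * y ^ 2 + b * x ^ 2 * y ^ 3 + y ^ 5 := by
  refine ⟨x ^ 3 + 2 * u * x ^ 2 * y + (3 * u ^ 2 + a) * x * y ^ 2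
    + (4 * u ^ 3 + 2 * a * u + b) * y ^ 3, ?_⟩
  linear_combination y ^ 5 * h₀ + (x * y ^ 4 - u * y ^ 5) * h₁

lemma deriv_ne_zero_of_squarefree {a b : ℂ} {i j : Fin 2} (hij : i ≠ j)
    (hsf : Squarefree (X i ^ 5 + C a * X i ^ 3 * X j ^ 2 + C b * X i ^ 2 * X j ^ 3 + X j ^ 5 :
      MvPolynomial (Fin 2) ℂ)) (u : ℂ) (h₀ : u ^ 5 + a * u ^ 3 + b * u ^ 2 + 1 = 0) :
    5 * u ^ 4 + 3 * a * u ^ 2 + 2 * b * u ≠ 0 := by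
  intro h₁
  have hd := sq_dvd_quintic (X i : MvPolynomial (Fin 2) ℂ) (X j) (C a) (C b) (C u)
    (by simpa using congrArg (C (σ := Fin 2)) h₀)
    (by simpa [map_ofNat] using congrArg (C (σ := Fin 2)) h₁)
  rw [sq] at hd
  have hu := (hsf _ hd).map (eval fun k => if k = i then u else 1)
  simp [hij.symm] at hu

/-- Near a point where a quintic has at most a simple zero, its small perturbations are bounded
below by the distance to a suitable point. -/
lemma exists_local_lower_bound (a b c u₀ : ℂ)
    (h : u₀ ^ 5 + a * u₀ ^ 3 + b * u₀ ^ 2 + 1 = 0 →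
      5 * u₀ ^ 4 + 3 * a * u₀ ^ 2 + 2 * b * u₀ ≠ 0) :
    ∃ ρ > 0, ∃ κ > 0, ∀ y : ℂ, ‖y‖ < ρ → ∃ P : ℂ, ∀ u ∈ Metric.ball u₀ ρ,
      κ * ‖u - P‖ ≤ ‖u ^ 5 + a * u ^ 3 + b * u ^ 2 + 1 + c * y * u ^ 3‖ ∧ ‖u - P‖ ≤ 1 := by
  by_cases h₀ : u₀ ^ 5 + a * u₀ ^ 3 + b * u₀ ^ 2 + 1 = 0
  · have hc : Continuous fun p : ℂ × ℂ × ℂ =>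
        ‖p.1 ^ 4 + p.1 ^ 3 * p.2.1 + p.1 ^ 2 * p.2.1 ^ 2 + p.1 * p.2.1 ^ 3 + p.2.1 ^ 4
          + (a + c * p.2.2) * (p.1 ^ 2 + p.1 * p.2.1 + p.2.1 ^ 2) + b * (p.1 + p.2.1)‖ := by
      fun_prop
    have hpos : 0 < ‖5 * u₀ ^ 4 + 3 * a * u₀ ^ 2 + 2 * b * u₀‖ := norm_pos_iff.2 (h h₀)
    have hev := (hc.tendsto (u₀, u₀, 0)).eventually_const_lt
      (u := ‖5 * u₀ ^ 4 + 3 * a * u₀ ^ 2 + 2 * b * u₀‖ / 2) (by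
        ring_nf at hpos ⊢
        linarith)
    set m := ‖5 * u₀ ^ 4 + 3 * a * u₀ ^ 2 + 2 * b * u₀‖ / 2
    obtain ⟨δ, hδ, hb⟩ := Metric.eventually_nhds_iff_ball.1 hev
    set ρ := min (δ / 2) (1 / 2)
    have hρ0 : 0 < ρ := by positivity
    have hρδ : ρ < δ := (min_le_left _ _).trans_lt (by linarith)
    have hρ1 : ρ ≤ 1 / 2 := min_le_right _ _
    refine ⟨ρ, hρ0, m / 2, by positivity, fun y hy => ?_⟩
    obtain ⟨P, hP, hmin⟩ := (isCompact_closedBall u₀ ρ).exists_isMinOn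
      ⟨u₀, Metric.mem_closedBall_self hρ0.le⟩
      (f := fun u : ℂ => ‖u ^ 5 + a * u ^ 3 + b * u ^ 2 + 1 + c * y * u ^ 3‖)
      (by fun_prop)
    refine ⟨P, fun u hu => ⟨?_, ?_⟩⟩
    · have hle := hmin (Metric.ball_subset_closedBall hu)
      simp only [Set.mem_ofPred_eq] at hle
      have hH := hb (u, P, y) (by
        rw [Metric.mem_ball] at hu ⊢
        rw [Metric.mem_closedBall] at hP
        simp only [Prod.dist_eq, dist_zero_right]
        exact max_lt (hu.trans hρδ) (max_lt (hP.trans_lt hρδ) (hy.trans hρδ)))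
      simp only at hH
      have heq : (u ^ 5 + a * u ^ 3 + b * u ^ 2 + 1 + c * y * u ^ 3)
          - (P ^ 5 + a * P ^ 3 + b * P ^ 2 + 1 + c * y * P ^ 3)
          = (u ^ 4 + u ^ 3 * P + u ^ 2 * P ^ 2 + u * P ^ 3 + P ^ 4
            + (a + c * y) * (u ^ 2 + u * P + P ^ 2) + b * (u + P)) * (u - P) := by ring
      have htri := norm_sub_le (u ^ 5 + a * u ^ 3 + b * u ^ 2 + 1 + c * y * u ^ 3)
        (P ^ 5 + a * P ^ 3 + b * P ^ 2 + 1 + c * y * P ^ 3)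
      rw [heq, norm_mul] at htri
      have := mul_le_mul_of_nonneg_right hH.le (norm_nonneg (u - P))
      linarith
    · rw [← dist_eq_norm]
      have := dist_triangle_right u P u₀
      rw [Metric.mem_ball] at hu
      rw [Metric.mem_closedBall] at hP
      linarith
  · have hc : Continuous fun p : ℂ × ℂ =>
        ‖p.1 ^ 5 + a * p.1 ^ 3 + b * p.1 ^ 2 + 1 + c * p.2 * p.1 ^ 3‖ := by fun_prop
    have hpos := norm_pos_iff.2 h₀
    have hev := (hc.tendsto (u₀, 0)).eventually_const_lt
      (u := ‖u₀ ^ 5 + a * u₀ ^ 3 + b * u₀ ^ 2 + 1‖ / 2) (by simpa using h₀)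
    obtain ⟨δ, hδ, hb⟩ := Metric.eventually_nhds_iff_ball.1 hev
    refine ⟨min δ 1, by positivity, _, half_pos hpos, fun y hy => ⟨u₀, fun u hu => ?_⟩⟩
    rw [Metric.mem_ball, dist_eq_norm, lt_min_iff] at hu
    have hG := hb (u, y) (by
      rw [Metric.mem_ball, Prod.dist_eq, dist_zero_right, dist_eq_norm]
      exact max_lt hu.1 (hy.trans_le (min_le_left _ _)))
    exact ⟨(mul_le_of_le_one_right (by positivity) hu.2.le).trans hG.le, hu.2.le⟩

/-- A uniform version of `exists_local_lower_bound` on the closed unit disc. -/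
lemma exists_uniform_lower_bound (a b c : ℂ)
    (h : ∀ u : ℂ, u ^ 5 + a * u ^ 3 + b * u ^ 2 + 1 = 0 →
      5 * u ^ 4 + 3 * a * u ^ 2 + 2 * b * u ≠ 0) :
    ∃ ε > 0, ∃ κ > 0, ∃ t : Finset ℂ, ∀ y : ℂ, ‖y‖ < ε → ∃ P : ℂ → ℂ, ∀ u : ℂ, ‖u‖ ≤ 1 →
      ∃ i ∈ t, κ * ‖u - P i‖ ≤ ‖u ^ 5 + a * u ^ 3 + b * u ^ 2 + 1 + c * y * u ^ 3‖ ∧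
        ‖u - P i‖ ≤ 1 := by
  choose ρ hρ κ hκ hP using fun u₀ => exists_local_lower_bound a b c u₀ (h u₀)
  obtain ⟨t, -, ht⟩ := (isCompact_closedBall (0 : ℂ) 1).elim_nhds_subcover
    (fun u => Metric.ball u (ρ u)) fun u _ => Metric.ball_mem_nhds u (hρ u)
  have hne : t.Nonempty := by
    by_contra hne
    rw [Finset.not_nonempty_iff_eq_empty] at hne
    subst hne
    simpa using ht (Metric.mem_closedBall_self zero_le_one)
  refine ⟨t.inf' hne ρ, (Finset.lt_inf'_iff hne).2 fun i _ => hρ i, t.inf' hne κ,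
    (Finset.lt_inf'_iff hne).2 fun i _ => hκ i, t, fun y hy => ?_⟩
  rw [Finset.lt_inf'_iff] at hy
  choose P hPs using fun i : t => hP i y (hy i i.2)
  refine ⟨fun i => if hi : i ∈ t then P ⟨i, hi⟩ else 0, fun u hu => ?_⟩
  obtain ⟨i, hi, hui⟩ := Set.mem_iUnion₂.1 (ht (mem_closedBall_zero_iff.2 hu))
  refine ⟨i, hi, ?_⟩
  simp only [hi, dite_true]
  obtain ⟨h₁, h₂⟩ := hPs ⟨i, hi⟩ u hui
  exact ⟨(mul_le_mul_of_nonneg_right (Finset.inf'_le _ hi) (norm_nonneg _)).trans h₁, h₂⟩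

lemma lintegral_ball_norm_rpow_lt_top {σ : ℝ} (hσ : σ < 2) (r : ℝ) :
    ∫⁻ z in Metric.ball (0 : ℂ) r, ENNReal.ofReal (‖z‖ ^ (-σ)) < ⊤ := by
  have hint : IntegrableOn (fun z : ℂ => ‖z‖ ^ (-σ)) (Metric.ball 0 r) volume :=
    integrableOn_ball_of_norm_le_rpow (C := 1) (α := σ) (by simp)
      (by simpa using hσ)
      (Filter.Eventually.of_forall fun z => by
        rw [one_mul, Real.norm_of_nonneg (by positivity)])
      (by fun_prop : Measurable fun z : ℂ => ‖z‖ ^ (-σ)).aestronglyMeasurable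
  exact hint.lintegral_lt_top

lemma rpow_neg_le_of_mul_le {κ r d v s t : ℝ} (hκ : 0 < κ) (hr : 0 < r) (hd : 0 < d)
    (hdr : d ≤ r) (hs : 0 ≤ s) (ht : 0 ≤ t) (hv : κ * r ^ 4 * d ≤ v) :
    v ^ (-s) ≤ κ ^ (-s) * r ^ (-(4 * s - t)) * d ^ (-(s + t)) := by
  calc v ^ (-s) ≤ (κ * r ^ 4 * d) ^ (-s) :=
        Real.rpow_le_rpow_of_nonpos (by positivity) hv (by linarith)
    _ = κ ^ (-s) * r ^ (-(4 * s)) * (d ^ t * d ^ (-(s + t))) := by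
        rw [Real.mul_rpow (by positivity) hd.le, Real.mul_rpow hκ.le (by positivity),
          ← Real.rpow_natCast r 4, ← Real.rpow_mul hr.le, ← Real.rpow_add hd]
        congr 2 <;> [congr 1; skip] <;> push_cast <;> ring_nf
    _ ≤ κ ^ (-s) * r ^ (-(4 * s)) * (r ^ t * d ^ (-(s + t))) := by gcongr
    _ = κ ^ (-s) * r ^ (-(4 * s - t)) * d ^ (-(s + t)) := by
        rw [show -(4 * s - t) = -(4 * s) + t by ring, Real.rpow_add hr]
        ring

/-- Integrability of the negative power on the part of a bidisc where `‖x‖ ≤ ‖y‖`. -/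
lemma exists_lintegral_cone_lt_top (a b c : ℂ)
    (h : ∀ u : ℂ, u ^ 5 + a * u ^ 3 + b * u ^ 2 + 1 = 0 →
      5 * u ^ 4 + 3 * a * u ^ 2 + 2 * b * u ≠ 0) {s : ℝ} (hs₀ : 0 ≤ s) (hs : s < 4 / 5) :
    ∃ ε > 0, ∫⁻ p in {p : ℂ × ℂ | ‖p.1‖ ≤ ‖p.2‖ ∧ ‖p.2‖ < ε},
      ENNReal.ofReal (‖p.1 ^ 5 + a * p.1 ^ 3 * p.2 ^ 2 + b * p.1 ^ 2 * p.2 ^ 3 + p.2 ^ 5 +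
        c * p.1 ^ 3 * p.2 ^ 3‖ ^ (-s)) < ⊤ := by
  obtain ⟨ε₀, hε₀, κ, hκ, t, hP⟩ := exists_uniform_lower_bound a b c h
  set ε := min ε₀ 1
  refine ⟨ε, by positivity, ?_⟩
  have hmeas : MeasurableSet {p : ℂ × ℂ | ‖p.1‖ ≤ ‖p.2‖ ∧ ‖p.2‖ < ε} := by
    have hle : MeasurableSet {p : ℂ × ℂ | ‖p.1‖ ≤ ‖p.2‖} :=
      measurableSet_le (by fun_prop) (by fun_prop)
    have hlt : MeasurableSet {p : ℂ × ℂ | ‖p.2‖ < ε} :=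
      measurableSet_lt (by fun_prop) (by fun_prop)
    exact hle.inter hlt
  rw [← lintegral_indicator hmeas, Measure.volume_eq_prod,
    lintegral_prod_symm _ ((Measurable.indicator (by fun_prop) hmeas).aemeasurable)]
  set ψ : ℂ → ENNReal := (Metric.ball (0 : ℂ) 1).indicator
    fun z => ENNReal.ofReal (‖z‖ ^ (-(s + 6 / 5))) with hψ
  have hψm : Measurable ψ := Measurable.indicator (by fun_prop) Metric.isOpen_ball.measurableSet
  set K := ∫⁻ z, ψ z with hK
  have hKtop : K < ⊤ := by
    rw [hK, hψ, lintegral_indicator Metric.isOpen_ball.measurableSet]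
    exact lintegral_ball_norm_rpow_lt_top (by linarith) 1
  have hfib : ∀ y : ℂ, y ≠ 0 → (∫⁻ x, {p : ℂ × ℂ | ‖p.1‖ ≤ ‖p.2‖ ∧ ‖p.2‖ < ε}.indicator
      (fun p => ENNReal.ofReal (‖p.1 ^ 5 + a * p.1 ^ 3 * p.2 ^ 2 + b * p.1 ^ 2 * p.2 ^ 3 + p.2 ^ 5 +
        c * p.1 ^ 3 * p.2 ^ 3‖ ^ (-s))) (x, y)) ≤
      (Metric.ball (0 : ℂ) ε).indicator (fun y => ENNReal.ofReal (κ ^ (-s)) *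
        (t.card * K) * ENNReal.ofReal (‖y‖ ^ (-(4 * s - 6 / 5)))) y := by
    intro y hy
    by_cases hyε : ‖y‖ < ε
    swap
    · simp [Set.indicator, hyε]
    obtain ⟨P, hPu⟩ := hP y (hyε.trans_le (min_le_left _ _))
    have hy1 : ‖y‖ < 1 := hyε.trans_le (min_le_right _ _)
    have hynorm : 0 < ‖y‖ := norm_pos_iff.2 hy
    have hae : ∀ᵐ x : ℂ, x ∉ (t.image fun i => P i * y : Finset ℂ) :=
      measure_eq_zero_iff_ae_notMem.1 ((Finset.finite_toSet _).measure_zero volume)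
    calc _ ≤ ∫⁻ x, ENNReal.ofReal (κ ^ (-s)) * ENNReal.ofReal (‖y‖ ^ (-(4 * s - 6 / 5))) *
          ∑ i ∈ t, ψ (x - P i * y) := by
          refine lintegral_mono_ae (hae.mono fun x hx => ?_)
          by_cases hxy : ‖x‖ ≤ ‖y‖
          swap
          · simp [Set.indicator, hxy]
          rw [Set.indicator_of_mem (show (x, y) ∈ {p : ℂ × ℂ | ‖p.1‖ ≤ ‖p.2‖ ∧ ‖p.2‖ < ε} from
            ⟨hxy, hyε⟩)]
          obtain ⟨i, hi, hlow, hclose⟩ := hPu (x / y) (by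
            rw [norm_div]; exact div_le_one_of_le₀ hxy (norm_nonneg _))
          have hdist : ‖x - P i * y‖ = ‖y‖ * ‖x / y - P i‖ := by
            rw [← norm_mul]; congr 1; field_simp
          have hd0 : 0 < ‖x - P i * y‖ := by
            rw [norm_pos_iff, sub_ne_zero]
            rintro rfl
            exact hx (Finset.mem_image_of_mem (fun i => P i * y) hi)
          have hdy : ‖x - P i * y‖ ≤ ‖y‖ := by
            rw [hdist]; exact mul_le_of_le_one_right hynorm.le hclose
          have hval : x ^ 5 + a * x ^ 3 * y ^ 2 + b * x ^ 2 * y ^ 3 + y ^ 5 + c * x ^ 3 * y ^ 3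
              = y ^ 5 * ((x / y) ^ 5 + a * (x / y) ^ 3 + b * (x / y) ^ 2 + 1
                + c * y * (x / y) ^ 3) := by field_simp
          have hmain := rpow_neg_le_of_mul_le (s := s) (t := 6 / 5)
            (v := ‖x ^ 5 + a * x ^ 3 * y ^ 2 + b * x ^ 2 * y ^ 3 + y ^ 5 + c * x ^ 3 * y ^ 3‖)
            hκ hynorm hd0 hdy hs₀ (by norm_num) (by
              rw [hval, hdist, norm_mul, norm_pow]
              calc _ = ‖y‖ ^ 5 * (κ * ‖x / y - P i‖) := by ring
                _ ≤ _ := by gcongr)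
          calc _ ≤ ENNReal.ofReal (κ ^ (-s) * ‖y‖ ^ (-(4 * s - 6 / 5)) *
                ‖x - P i * y‖ ^ (-(s + 6 / 5))) := ENNReal.ofReal_le_ofReal hmain
            _ = ENNReal.ofReal (κ ^ (-s)) * ENNReal.ofReal (‖y‖ ^ (-(4 * s - 6 / 5))) *
                ψ (x - P i * y) := by
                rw [ENNReal.ofReal_mul (by positivity), ENNReal.ofReal_mul (by positivity), hψ,
                  Set.indicator_of_mem (mem_ball_zero_iff.2 (hdy.trans_lt hy1))]
            _ ≤ _ := by
                gcongr
                exact Finset.single_le_sum (f := fun i => ψ (x - P i * y))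
                  (fun _ _ => zero_le) hi
      _ = ENNReal.ofReal (κ ^ (-s)) * ENNReal.ofReal (‖y‖ ^ (-(4 * s - 6 / 5))) *
          (t.card * K) := by
          rw [lintegral_const_mul _ (by fun_prop), lintegral_finsetSum _ (by fun_prop)]
          simp [lintegral_sub_right_eq_self ψ, ← hK]
      _ = _ := by
          rw [Set.indicator_of_mem (mem_ball_zero_iff.2 hyε)]
          ring
  calc _ ≤ ∫⁻ y, (Metric.ball (0 : ℂ) ε).indicator (fun y => ENNReal.ofReal (κ ^ (-s)) *
        (t.card * K) * ENNReal.ofReal (‖y‖ ^ (-(4 * s - 6 / 5)))) y :=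
        lintegral_mono_ae ((Measure.ae_ne volume (0 : ℂ)).mono hfib)
    _ = ENNReal.ofReal (κ ^ (-s)) * (t.card * K) *
        ∫⁻ y in Metric.ball (0 : ℂ) ε, ENNReal.ofReal (‖y‖ ^ (-(4 * s - 6 / 5))) := by
        rw [lintegral_indicator Metric.isOpen_ball.measurableSet,
          lintegral_const_mul _ (by fun_prop)]
    _ < ⊤ := ENNReal.mul_lt_top (ENNReal.mul_lt_top ENNReal.ofReal_lt_top
        (ENNReal.mul_lt_top (ENNReal.natCast_lt_top _) hKtop))
        (lintegral_ball_norm_rpow_lt_top (by linarith) ε)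

lemma exists_integrableOn_ball (a b c : ℂ)
    (h : ∀ u : ℂ, u ^ 5 + a * u ^ 3 + b * u ^ 2 + 1 = 0 →
      5 * u ^ 4 + 3 * a * u ^ 2 + 2 * b * u ≠ 0)
    (h' : ∀ u : ℂ, u ^ 5 + b * u ^ 3 + a * u ^ 2 + 1 = 0 →
      5 * u ^ 4 + 3 * b * u ^ 2 + 2 * a * u ≠ 0) {s : ℝ} (hs₀ : 0 ≤ s) (hs : s < 4 / 5) :
    ∃ ε : ℝ, 0 < ε ∧ IntegrableOn (fun p : ℂ × ℂ =>
      ‖p.1 ^ 5 + a * p.1 ^ 3 * p.2 ^ 2 + b * p.1 ^ 2 * p.2 ^ 3 + p.2 ^ 5 +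
        c * p.1 ^ 3 * p.2 ^ 3‖ ^ (-s)) (Metric.ball (0 : ℂ × ℂ) ε) volume := by
  obtain ⟨ε₁, hε₁, hI₁⟩ := exists_lintegral_cone_lt_top a b c h hs₀ hs
  obtain ⟨ε₂, hε₂, hI₂⟩ := exists_lintegral_cone_lt_top b a c h' hs₀ hs
  have hswap : MeasurePreserving (Prod.swap : ℂ × ℂ → ℂ × ℂ) volume volume :=
    Measure.measurePreserving_swap
  rw [← hswap.setLIntegral_comp_preimage_emb MeasurableEquiv.prodComm.measurableEmbedding] at hI₂
  refine ⟨min ε₁ ε₂, by positivity, (by fun_prop : Measurable _).aestronglyMeasurable, ?_⟩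
  rw [hasFiniteIntegral_iff_ofReal (Filter.Eventually.of_forall fun p => by positivity)]
  refine (lintegral_mono_set ?_).trans_lt
    ((lintegral_union_le _ {p : ℂ × ℂ | ‖p.1‖ ≤ ‖p.2‖ ∧ ‖p.2‖ < ε₁}
      (Prod.swap ⁻¹' {p : ℂ × ℂ | ‖p.1‖ ≤ ‖p.2‖ ∧ ‖p.2‖ < ε₂})).trans_lt
      (ENNReal.add_lt_top.2 ⟨hI₁, lt_of_eq_of_lt ?_ hI₂⟩))
  · intro p hp
    rw [mem_ball_zero_iff, Prod.norm_def, max_lt_iff, lt_min_iff, lt_min_iff] at hp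
    rcases le_total ‖p.1‖ ‖p.2‖ with hle | hle
    · exact Or.inl ⟨hle, hp.2.1⟩
    · exact Or.inr ⟨hle, hp.1.2⟩
  · refine lintegral_congr fun p => ?_
    simp only [Prod.fst_swap, Prod.snd_swap]
    congr 3
    ring

lemma not_integrableOn_ball (a b c : ℂ) {s : ℝ} (hs : 4 / 5 < s) {ε : ℝ} (hε : 0 < ε) :
    ¬ IntegrableOn (fun p : ℂ × ℂ =>
      ‖p.1 ^ 5 + a * p.1 ^ 3 * p.2 ^ 2 + b * p.1 ^ 2 * p.2 ^ 3 + p.2 ^ 5 +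
        c * p.1 ^ 3 * p.2 ^ 3‖ ^ (-s)) (Metric.ball (0 : ℂ × ℂ) ε) volume := by
  intro hint
  have hHaar : (volume : Measure (ℂ × ℂ)).IsAddHaarMeasure :=
    inferInstanceAs ((volume : Measure ℂ).prod (volume : Measure ℂ)).IsAddHaarMeasure
  set F : ℂ × ℂ → ℝ := fun p =>
      ‖p.1 ^ 5 + a * p.1 ^ 3 * p.2 ^ 2 + b * p.1 ^ 2 * p.2 ^ 3 + p.2 ^ 5 +
        c * p.1 ^ 3 * p.2 ^ 3‖ ^ (-s) with hF
  have hc : Continuous fun q : (ℂ × ℂ) × ℂ =>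
      ‖q.1.1 ^ 5 + a * q.1.1 ^ 3 * q.1.2 ^ 2 + b * q.1.1 ^ 2 * q.1.2 ^ 3 + q.1.2 ^ 5 +
        c * q.2 * q.1.1 ^ 3 * q.1.2 ^ 3‖ := by fun_prop
  have hev := ((hc.tendsto ((0, 1), 0)).eventually_const_lt (u := 0) (by simp)).and
    ((hc.tendsto ((0, 1), 0)).eventually_lt_const (u := 2) (by simp))
  obtain ⟨η, hη, hb⟩ := Metric.eventually_nhds_iff_ball.1 hev
  set V := volume.real (Metric.ball (0 : ℂ × ℂ) 1) with hV
  have hVpos : 0 < V := by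
    rw [hV, measureReal_def]
    exact ENNReal.toReal_pos (Metric.measure_ball_pos _ _ one_pos).ne' measure_ball_lt_top.ne
  have hbound : ∀ δ : ℝ, 0 < δ → δ < min η (ε / (1 + η)) →
      2 ^ (-s) * η ^ 4 * V * δ ^ (4 - 5 * s) ≤ ∫ p in Metric.ball (0 : ℂ × ℂ) ε, F p := by
    intro δ hδ hδη
    rw [lt_min_iff, lt_div_iff₀ (by positivity)] at hδη
    have hsub : Metric.ball ((0, (δ : ℂ)) : ℂ × ℂ) (δ * η) ⊆ Metric.ball 0 ε := by
      refine Metric.ball_subset_ball' ?_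
      rw [dist_zero_right, Prod.norm_def]
      simp [abs_of_pos hδ, hδ.le]
      linarith
    have hlow : ∀ p ∈ Metric.ball ((0, (δ : ℂ)) : ℂ × ℂ) (δ * η),
        2 ^ (-s) * δ ^ (-(5 * s)) ≤ F p := by
      intro p hp
      have hδ' : (δ : ℂ) ≠ 0 := by exact_mod_cast hδ.ne'
      obtain ⟨h₁, h₂⟩ := hb ((p.1 / δ, p.2 / δ), δ) (by
        simp only [Metric.mem_ball, Prod.dist_eq, dist_zero_right, max_lt_iff] at hp ⊢
        rw [dist_eq_norm] at hp ⊢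
        refine ⟨⟨?_, ?_⟩, ?_⟩
        · rw [norm_div, Complex.norm_real, Real.norm_of_nonneg hδ.le, div_lt_iff₀' hδ]
          exact hp.1
        · rw [div_sub_one hδ', norm_div, Complex.norm_real, Real.norm_of_nonneg hδ.le,
            div_lt_iff₀' hδ]
          exact hp.2
        · rw [Complex.norm_real, Real.norm_of_nonneg hδ.le]
          exact hδη.1)
      simp only at h₁ h₂
      set g := (p.1 / δ) ^ 5 + a * (p.1 / δ) ^ 3 * (p.2 / δ) ^ 2 + b * (p.1 / δ) ^ 2 *
        (p.2 / δ) ^ 3 + (p.2 / δ) ^ 5 + c * δ * (p.1 / δ) ^ 3 * (p.2 / δ) ^ 3 with hg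
      have hval : p.1 ^ 5 + a * p.1 ^ 3 * p.2 ^ 2 + b * p.1 ^ 2 * p.2 ^ 3 + p.2 ^ 5 +
          c * p.1 ^ 3 * p.2 ^ 3 = δ ^ 5 * g := by
        rw [hg]; field_simp
      simp only [hF]
      rw [hval, norm_mul, norm_pow, Complex.norm_real, Real.norm_of_nonneg hδ.le,
        Real.mul_rpow (by positivity) (norm_nonneg _), ← Real.rpow_natCast δ 5,
        ← Real.rpow_mul hδ.le, mul_comm]
      have := Real.rpow_le_rpow_of_nonpos h₁ h₂.le (by linarith : -s ≤ 0)
      rw [show ((5 : ℕ) : ℝ) * -s = -(5 * s) by push_cast; ring]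
      gcongr
    calc 2 ^ (-s) * η ^ 4 * V * δ ^ (4 - 5 * s)
        = 2 ^ (-s) * δ ^ (-(5 * s)) *
          volume.real (Metric.ball ((0, (δ : ℂ)) : ℂ × ℂ) (δ * η)) := by
          rw [measureReal_def, Measure.addHaar_ball_of_pos _ _ (by positivity), ENNReal.toReal_mul,
            ENNReal.toReal_ofReal (by positivity), ← measureReal_def, ← hV, sub_eq_add_neg,
            Real.rpow_add hδ]
          have : Module.finrank ℝ (ℂ × ℂ) = 4 := by simp
          rw [this, mul_pow, show (4 : ℝ) = ((4 : ℕ) : ℝ) by norm_num, Real.rpow_natCast]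
          ring
      _ ≤ ∫ p in Metric.ball ((0, (δ : ℂ)) : ℂ × ℂ) (δ * η), F p :=
          setIntegral_ge_of_const_le_real Metric.isOpen_ball.measurableSet
            measure_ball_lt_top.ne hlow (hint.mono_set hsub)
      _ ≤ ∫ p in Metric.ball (0 : ℂ × ℂ) ε, F p :=
          setIntegral_mono_set hint (Filter.Eventually.of_forall fun p => by
            simp only [hF, Pi.zero_apply]; positivity) hsub.eventuallyLE
  have htend := (tendsto_rpow_neg_nhdsGT_zero (y := 4 - 5 * s) (by linarith)).const_mul_atTop
    (show 0 < 2 ^ (-s) * η ^ 4 * V by positivity)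
  obtain ⟨δ, hδ, hδ'⟩ := ((htend.eventually_gt_atTop
    (∫ p in Metric.ball (0 : ℂ × ℂ) ε, F p)).and
    (Ioo_mem_nhdsGT (show 0 < min η (ε / (1 + η)) by positivity))).exists
  exact (hbound δ hδ'.1 hδ'.2).not_gt hδ

theorem lct_N16 (a b c : ℂ)
    (hsf : Squarefree (X 0 ^ 5 + C a * X 0 ^ 3 * X 1 ^ 2 + C b * X 0 ^ 2 * X 1 ^ 3 + X 1 ^ 5 :
      MvPolynomial (Fin 2) ℂ)) :
    lct₀ (fun p : ℂ × ℂ =>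
      p.1 ^ 5 + a * p.1 ^ 3 * p.2 ^ 2 + b * p.1 ^ 2 * p.2 ^ 3 + p.2 ^ 5 +
        c * p.1 ^ 3 * p.2 ^ 3) = 2 / 5 := by
  have hq := deriv_ne_zero_of_squarefree (by decide) hsf
  have hq' := deriv_ne_zero_of_squarefree (a := b) (b := a) (i := 1) (j := 0) (by decide) (by
    convert hsf using 1; ring)
  have hmem : ∀ r : ℝ, 0 ≤ r → r < 2 / 5 → r ∈ { r : ℝ | 0 ≤ r ∧ ∃ ε : ℝ, 0 < ε ∧
      IntegrableOn (fun p : ℂ × ℂ => ‖p.1 ^ 5 + a * p.1 ^ 3 * p.2 ^ 2 + b * p.1 ^ 2 * p.2 ^ 3 +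
        p.2 ^ 5 + c * p.1 ^ 3 * p.2 ^ 3‖ ^ (-2 * r)) (Metric.ball (0 : ℂ × ℂ) ε) volume } := by
    intro r hr₀ hr
    refine ⟨hr₀, ?_⟩
    simpa only [neg_mul] using
      exists_integrableOn_ball a b c hq hq' (s := 2 * r) (by linarith) (by linarith)
  unfold lct₀
  refine csSup_eq_of_forall_le_of_forall_lt_exists_gt ⟨0, hmem 0 le_rfl (by norm_num)⟩ ?_ ?_
  · rintro r ⟨-, ε, hε, hint⟩
    by_contra! hr
    exact not_integrableOn_ball a b c (s := 2 * r) (by linarith) hε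
      (by simpa only [neg_mul] using hint)
  · intro w hw
    obtain ⟨r, hr, hr'⟩ := exists_between (max_lt hw (show (0 : ℝ) < 2 / 5 by norm_num))
    exact ⟨r, hmem r ((le_max_right _ _).trans hr.le) hr', (le_max_left _ _).trans_lt hr⟩
end
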